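/- Fix M > 0 and an integer ℓ ≥ 2, set V := (Ω²/r²)·( ℓ(ℓ+1) − 6M/r ) on D, and let Φ : D → ℝ be a smooth solution of the fixed-angular-mode Regge–Wheeler equation ∂_u∂_vΦ = −V·Φ. Assume the scattering data of Φ vanish, i.e.: Φ(u,1) = 0 for all u ≤ −1 (vanishing data on the ingoing cone C = {v=1}), and for every v ≥ 1 the incoming energy flux vanishes in the limit: ∫₁^v [ (∂_vΦ)²(u,v′) + V(u,v′)·Φ²(u,v′) ] dv′ → 0 as u → −∞ (vanishing data at past null infinity). Then Φ ≡ 0 on D. (This is the uniqueness part of the scattering theory for the Regge–Wheeler equation from C ∪ ℐ⁻, proved via the conserved energy.) -/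

import Mathlib

noncomputable section
open Real Set Filter

/-- The domain `D = {(u,v) : u ≤ -1, v ≥ 1}`. -/
def D : Set (ℝ × ℝ) := {p | p.1 ≤ -1 ∧ 1 ≤ p.2}

/-- `Ω² = 1 - 2M/r`. -/
def Om2 (M : ℝ) (r : ℝ → ℝ → ℝ) (u v : ℝ) : ℝ := 1 - 2 * M / r u v

/-- `r` is the Schwarzschild area radius in double null coordinates on `D`:
smooth, `> 2M`, satisfying `r + 2M log(r/(2M)-1) = v - u` and
`∂_v r = 1 - 2M/r = -∂_u r`. -/
structure IsSchwR (M : ℝ) (r : ℝ → ℝ → ℝ) : Prop where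
  smooth : ContDiffOn ℝ (⊤ : ℕ∞) (fun p : ℝ × ℝ => r p.1 p.2) D
  gt2M : ∀ u v : ℝ, (u, v) ∈ D → 2 * M < r u v
  eqn : ∀ u v : ℝ, (u, v) ∈ D →
    r u v + 2 * M * Real.log (r u v / (2 * M) - 1) = v - u
  dv : ∀ u v : ℝ, (u, v) ∈ D →
    deriv (fun v' => r u v') v = 1 - 2 * M / r u v
  du : ∀ u v : ℝ, (u, v) ∈ D →
    deriv (fun u' => r u' v) u = -(1 - 2 * M / r u v)

open MeasureTheory intervalIntegral

lemma mem_nhds_D {u v : ℝ} (hu : u < -1) (hv : 1 < v) : D ∈ nhds (u, v) := by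
  have h : Iic (-1 : ℝ) ×ˢ Ici (1 : ℝ) ∈ nhds (u, v) :=
    prod_mem_nhds (Iic_mem_nhds hu) (Ici_mem_nhds hv)
  exact h

lemma uniqueDiffOn_D : UniqueDiffOn ℝ D :=
  (uniqueDiffOn_Iic (-1 : ℝ)).prod (uniqueDiffOn_Ici (1 : ℝ))

lemma HasFDerivAt.hasDerivAt_left {f : ℝ × ℝ → ℝ} {f' : ℝ × ℝ →L[ℝ] ℝ} {u v : ℝ}
    (h : HasFDerivAt f f' (u, v)) : HasDerivAt (fun t => f (t, v)) (f' (1, 0)) u :=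
  h.comp_hasDerivAt u ((hasDerivAt_id u).prodMk (hasDerivAt_const u v))

lemma HasFDerivAt.hasDerivAt_right {f : ℝ × ℝ → ℝ} {f' : ℝ × ℝ →L[ℝ] ℝ} {u v : ℝ}
    (h : HasFDerivAt f f' (u, v)) : HasDerivAt (fun t => f (u, t)) (f' (0, 1)) v :=
  h.comp_hasDerivAt v ((hasDerivAt_const v u).prodMk (hasDerivAt_id v))

/-- The Regge–Wheeler potential as a function of the area radius. -/
def reggeWheelerPotential (M L x : ℝ) : ℝ := (1 - 2 * M / x) / x ^ 2 * (L - 6 * M / x)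

lemma reggeWheelerPotential_pos {M L x : ℝ} (hM : 0 < M) (hL : 3 ≤ L) (hx : 2 * M < x) :
    0 < reggeWheelerPotential M L x := by
  have hx0 : 0 < x := by linarith
  have h1 : 2 * M / x < 1 := (div_lt_one hx0).2 hx
  have h2 : 6 * M / x = 3 * (2 * M / x) := by ring
  unfold reggeWheelerPotential
  have h3 : 0 < 1 - 2 * M / x := by linarith
  have h4 : 0 < L - 6 * M / x := by linarith
  positivity

lemma differentiableAt_reggeWheelerPotential {M L x : ℝ} (hx : x ≠ 0) :
    DifferentiableAt ℝ (reggeWheelerPotential M L) x := by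
  unfold reggeWheelerPotential
  fun_prop (disch := simp [hx])

lemma IsSchwR.differentiableAt {M : ℝ} {r : ℝ → ℝ → ℝ} (hr : IsSchwR M r) {u v : ℝ}
    (hu : u < -1) (hv : 1 < v) : DifferentiableAt ℝ (fun p : ℝ × ℝ => r p.1 p.2) (u, v) :=
  (hr.smooth.contDiffAt (mem_nhds_D hu hv)).differentiableAt (by simp)

/-- The area radius, hence every function of it, is stationary. -/
lemma IsSchwR.exists_hasFDerivAt_comp {M : ℝ} {r : ℝ → ℝ → ℝ} (hr : IsSchwR M r) {W : ℝ → ℝ}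
    {u v : ℝ} (hu : u < -1) (hv : 1 < v) (hW : DifferentiableAt ℝ W (r u v)) :
    ∃ V' : ℝ × ℝ →L[ℝ] ℝ,
      HasFDerivAt (fun p : ℝ × ℝ => W (r p.1 p.2)) V' (u, v) ∧ V' (1, 0) + V' (0, 1) = 0 := by
  have hd := (hr.differentiableAt hu hv).hasFDerivAt
  have h1 := hd.hasDerivAt_left.deriv
  have h2 := hd.hasDerivAt_right.deriv
  rw [hr.du u v ⟨hu.le, hv.le⟩] at h1
  rw [hr.dv u v ⟨hu.le, hv.le⟩] at h2
  refine ⟨_, hW.hasDerivAt.comp_hasFDerivAt (u, v) hd, ?_⟩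
  simp only [smul_apply, ← h1, ← h2, smul_eq_mul]
  ring

/-- The density `(∂φ)² + V φ²` of the energy flux, where `∂φ` is the derivative in direction `e`. -/
def fluxDensity (V φ : ℝ × ℝ → ℝ) (A : ℝ × ℝ → ℝ × ℝ →L[ℝ] ℝ) (e p : ℝ × ℝ) : ℝ :=
  A p e ^ 2 + V p * φ p ^ 2

/-- Local conservation of energy for `∂_u∂_vφ = -Vφ` with a stationary potential `V`. -/
lemma exists_hasFDerivAt_fluxDensity {V φ : ℝ × ℝ → ℝ} {A : ℝ × ℝ → ℝ × ℝ →L[ℝ] ℝ}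
    {A' : ℝ × ℝ →L[ℝ] ℝ × ℝ →L[ℝ] ℝ} {V' : ℝ × ℝ →L[ℝ] ℝ} {p : ℝ × ℝ}
    (hφ : HasFDerivAt φ (A p) p) (hA : HasFDerivAt A A' p) (hV : HasFDerivAt V V' p)
    (hV' : V' (1, 0) + V' (0, 1) = 0) (huv : A' (1, 0) (0, 1) = -V p * φ p)
    (hvu : A' (0, 1) (1, 0) = -V p * φ p) :
    ∃ f' g' : ℝ × ℝ →L[ℝ] ℝ, HasFDerivAt (fluxDensity V φ A (0, 1)) f' p ∧
      HasFDerivAt (fluxDensity V φ A (1, 0)) g' p ∧ f' (1, 0) + g' (0, 1) = 0 := by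
  have hVφ := hV.mul (hφ.pow 2)
  have hAe (e : ℝ × ℝ) : HasFDerivAt (fun q => A q e) (A'.flip e) p := by
    simpa using hA.clm_apply (hasFDerivAt_const e p)
  refine ⟨_, _, ((hAe (0, 1)).pow 2).add hVφ, ((hAe (1, 0)).pow 2).add hVφ, ?_⟩
  simp [huv, hvu]
  linear_combination φ p ^ 2 * hV'

lemma hasFDerivAt_fderivWithin_D {φ : ℝ × ℝ → ℝ} (hφ : ContDiffOn ℝ (⊤ : ℕ∞) φ D) {u v : ℝ}
    (hu : u < -1) (hv : 1 < v) : HasFDerivAt φ (fderivWithin ℝ φ D (u, v)) (u, v) := by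
  have hD := mem_nhds_D hu hv
  rw [fderivWithin_of_mem_nhds hD]
  exact ((hφ.contDiffAt hD).differentiableAt (by simp)).hasFDerivAt

/-- At interior points, the energy fluxes of a solution through the two families of cones form
a divergence-free field. -/
lemma exists_hasFDerivAt_fluxDensity_of_wave {V φ : ℝ × ℝ → ℝ}
    (hφ : ContDiffOn ℝ (⊤ : ℕ∞) φ D) {u v : ℝ} (hu : u < -1) (hv : 1 < v)
    (hwave : deriv (fun u' => deriv (fun v' => φ (u', v')) v) u = -V (u, v) * φ (u, v))
    {V' : ℝ × ℝ →L[ℝ] ℝ} (hV : HasFDerivAt V V' (u, v)) (hV' : V' (1, 0) + V' (0, 1) = 0) :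
    ∃ f' g' : ℝ × ℝ →L[ℝ] ℝ,
      HasFDerivAt (fluxDensity V φ (fderivWithin ℝ φ D) (0, 1)) f' (u, v) ∧
      HasFDerivAt (fluxDensity V φ (fderivWithin ℝ φ D) (1, 0)) g' (u, v) ∧
      f' (1, 0) + g' (0, 1) = 0 := by
  have hD := mem_nhds_D hu hv
  have hA : HasFDerivAt (fderivWithin ℝ φ D) (fderiv ℝ (fderivWithin ℝ φ D) (u, v)) (u, v) :=
    (((hφ.fderivWithin uniqueDiffOn_D (m := 1) (by norm_cast)).contDiffAt hD).differentiableAt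
      (by simp)).hasFDerivAt
  have heq : fderivWithin ℝ φ D =ᶠ[nhds (u, v)] fderiv ℝ φ := by
    filter_upwards [eventually_mem_nhds_iff.2 hD] with q hq using fderivWithin_of_mem_nhds hq
  have hsymm : IsSymmSndFDerivAt ℝ φ (u, v) :=
    (hφ.contDiffAt hD).isSymmSndFDerivAt (by simp; norm_cast)
  have hslice : (fun u' => deriv (fun v' => φ (u', v')) v) =ᶠ[nhds u]
      fun u' => fderivWithin ℝ φ D (u', v) (0, 1) := by
    filter_upwards [Iio_mem_nhds hu] with u' hu'
    exact (hasFDerivAt_fderivWithin_D hφ hu' hv).hasDerivAt_right.deriv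
  have huv : fderiv ℝ (fderivWithin ℝ φ D) (u, v) (1, 0) (0, 1) = -V (u, v) * φ (u, v) := by
    have hAe : HasFDerivAt (fun q => fderivWithin ℝ φ D q (0, 1))
        ((fderiv ℝ (fderivWithin ℝ φ D) (u, v)).flip (0, 1)) (u, v) := by
      simpa using hA.clm_apply (hasFDerivAt_const ((0, 1) : ℝ × ℝ) (u, v))
    rw [← hwave, hslice.deriv_eq, hAe.hasDerivAt_left.deriv]
    rfl
  refine exists_hasFDerivAt_fluxDensity (hasFDerivAt_fderivWithin_D hφ hu hv) hA hV hV' huv ?_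
  rw [← huv, heq.fderiv_eq]
  exact hsymm (0, 1) (1, 0)

lemma continuousOn_fluxDensity {V φ : ℝ × ℝ → ℝ} (hV : ContinuousOn V D)
    (hφ : ContDiffOn ℝ (⊤ : ℕ∞) φ D) (e : ℝ × ℝ) :
    ContinuousOn (fluxDensity V φ (fderivWithin ℝ φ D) e) D :=
  (((hφ.continuousOn_fderivWithin uniqueDiffOn_D (by norm_cast)).clm_apply
    continuousOn_const).pow 2).add (hV.mul (hφ.continuousOn.pow 2))

/-- A divergence-free field with no flux through the bottom edge and nonnegative flux through
the top edge has nonincreasing flux through the vertical edges. -/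
lemma integral_right_le_integral_left {f g : ℝ × ℝ → ℝ} {u₁ u₂ a b : ℝ} (hu : u₁ ≤ u₂)
    (hab : a ≤ b) (hf : ContinuousOn f (Icc u₁ u₂ ×ˢ Icc a b))
    (hg : ContinuousOn g (Icc u₁ u₂ ×ˢ Icc a b))
    (hdiv : ∀ u v, u ∈ Ioo u₁ u₂ → v ∈ Ioo a b → ∃ f' g' : ℝ × ℝ →L[ℝ] ℝ,
      HasFDerivAt f f' (u, v) ∧ HasFDerivAt g g' (u, v) ∧ f' (1, 0) + g' (0, 1) = 0)
    (hbot : ∀ u ∈ Icc u₁ u₂, g (u, a) = 0) (htop : ∀ u ∈ Icc u₁ u₂, 0 ≤ g (u, b)) :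
    ∫ w in a..b, f (u₂, w) ≤ ∫ w in a..b, f (u₁, w) := by
  have hex : ∀ p : ℝ × ℝ, ∃ f' g' : ℝ × ℝ →L[ℝ] ℝ,
      (p ∈ Ioo u₁ u₂ ×ˢ Ioo a b → HasFDerivAt f f' p ∧ HasFDerivAt g g' p) ∧
        f' (1, 0) + g' (0, 1) = 0 := by
    intro p
    by_cases hp : p ∈ Ioo u₁ u₂ ×ˢ Ioo a b
    · obtain ⟨f', g', h1, h2, h3⟩ := hdiv p.1 p.2 hp.1 hp.2
      exact ⟨f', g', fun _ => ⟨h1, h2⟩, h3⟩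
    · exact ⟨0, 0, fun h => absurd h hp, by simp⟩
  choose f' g' hd hzero using hex
  have key := integral2_divergence_prod_of_hasFDerivAt_off_countable f g f' g' u₁ a u₂ b ∅
    countable_empty (by rwa [uIcc_of_le hu, uIcc_of_le hab])
    (by rwa [uIcc_of_le hu, uIcc_of_le hab])
    (fun x hx => by
      rw [min_eq_left hu, max_eq_right hu, min_eq_left hab, max_eq_right hab] at hx
      exact (hd x hx.1).1)
    (fun x hx => by
      rw [min_eq_left hu, max_eq_right hu, min_eq_left hab, max_eq_right hab] at hx
      exact (hd x hx.1).2)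
    (by simp [hzero])
  have h0 : ∫ x in u₁..u₂, g (x, a) = 0 := by
    rw [integral_congr (g := fun _ => (0 : ℝ)) fun x hx => hbot x (by rwa [uIcc_of_le hu] at hx)]
    simp
  have h1 : 0 ≤ ∫ x in u₁..u₂, g (x, b) := integral_nonneg hu htop
  simp only [hzero, h0, intervalIntegral.integral_zero] at key
  linarith

/-- Uniqueness in the scattering theory for the fixed-angular-mode Regge–Wheeler equation:
a smooth solution of `∂_u∂_vΦ = −VΦ` with vanishing data on the ingoing cone `{v = 1}` and
vanishing incoming energy flux at past null infinity vanishes identically on `D`. -/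
theorem regge_wheeler_scattering_uniqueness (M : ℝ) (hM : 0 < M)
    (r : ℝ → ℝ → ℝ) (hr : IsSchwR M r) (ℓ : ℕ) (hℓ : 2 ≤ ℓ)
    (Φ : ℝ → ℝ → ℝ) (hΦ : ContDiffOn ℝ (⊤ : ℕ∞) (fun p : ℝ × ℝ => Φ p.1 p.2) D)
    (hRW : ∀ u v : ℝ, (u, v) ∈ D →
      deriv (fun u' => deriv (fun v' => Φ u' v') v) u
        = -(Om2 M r u v / (r u v) ^ 2 * ((ℓ : ℝ) * ((ℓ : ℝ) + 1) - 6 * M / r u v)) * Φ u v)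
    (hcone : ∀ u : ℝ, u ≤ -1 → Φ u 1 = 0)
    (hflux : ∀ v : ℝ, 1 ≤ v →
      Tendsto (fun u => ∫ w in (1 : ℝ)..v,
          ((deriv (fun t => Φ u t) w) ^ 2
            + Om2 M r u w / (r u w) ^ 2 * ((ℓ : ℝ) * ((ℓ : ℝ) + 1) - 6 * M / r u w) *
              (Φ u w) ^ 2)) atBot (nhds 0)) :
    ∀ u v : ℝ, (u, v) ∈ D → Φ u v = 0 := by
  set φ : ℝ × ℝ → ℝ := fun p => Φ p.1 p.2
  set V : ℝ × ℝ → ℝ :=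
    fun p => reggeWheelerPotential M ((ℓ : ℝ) * ((ℓ : ℝ) + 1)) (r p.1 p.2)
  set f := fluxDensity V φ (fderivWithin ℝ φ D) (0, 1) with hf
  set g := fluxDensity V φ (fderivWithin ℝ φ D) (1, 0) with hg
  have hL : (3 : ℝ) ≤ (ℓ : ℝ) * ((ℓ : ℝ) + 1) := by
    have : (2 : ℝ) ≤ ℓ := by exact_mod_cast hℓ
    nlinarith
  have hVpos : ∀ p ∈ D, 0 < V p := fun p hp => reggeWheelerPotential_pos hM hL (hr.gt2M _ _ hp)
  have hr0 : ∀ p ∈ D, r p.1 p.2 ≠ 0 := fun p hp => by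
    have := hr.gt2M _ _ hp
    linarith
  have hVcont : ContinuousOn V D := fun p hp =>
    ContinuousAt.comp_continuousWithinAt (f := fun p : ℝ × ℝ => r p.1 p.2)
      (differentiableAt_reggeWheelerPotential (hr0 p hp)).continuousAt (hr.smooth.continuousOn p hp)
  have hfcont : ContinuousOn f D := continuousOn_fluxDensity hVcont hΦ _
  have hgcont : ContinuousOn g D := continuousOn_fluxDensity hVcont hΦ _
  have hnonneg : ∀ e, ∀ p ∈ D, 0 ≤ fluxDensity V φ (fderivWithin ℝ φ D) e p := fun e p hp => by
    have := hVpos p hp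
    unfold fluxDensity
    positivity
  have hbot : ∀ u ≤ -1, g (u, 1) = 0 := by
    intro u hu
    have hd : HasFDerivWithinAt φ (fderivWithin ℝ φ D (u, 1)) D (u, 1) :=
      (hΦ.differentiableOn (by simp) (u, 1) ⟨hu, le_rfl⟩).hasFDerivWithinAt
    have hc : HasDerivWithinAt (fun t => φ (t, 1)) (fderivWithin ℝ φ D (u, 1) (1, 0)) (Iic (-1)) u := by
      have hmaps : MapsTo (fun t : ℝ => (t, (1 : ℝ))) (Iic (-1)) D := fun t ht => ⟨ht, le_rfl⟩
      exact hd.comp_hasDerivWithinAt u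
        ((hasDerivWithinAt_id u _).prodMk (hasDerivWithinAt_const u _ (1 : ℝ))) hmaps
    have hz : HasDerivWithinAt (fun t => φ (t, 1)) 0 (Iic (-1)) u :=
      (hasDerivWithinAt_const u _ (0 : ℝ)).congr (fun t ht => hcone t ht) (hcone u hu)
    have h0 := (uniqueDiffOn_Iic (-1 : ℝ) u hu).eq_deriv _ hc hz
    have hφ0 : φ (u, 1) = 0 := hcone u hu
    simp [hg, fluxDensity, h0, hφ0]
  intro u v huv
  obtain ⟨hu : u ≤ -1, hv : 1 ≤ v⟩ := huv
  rcases hv.eq_or_lt with rfl | hv1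
  · exact hcone u hu
  have hmono : ∀ u₁ ≤ u, ∫ w in (1 : ℝ)..v, f (u, w) ≤ ∫ w in (1 : ℝ)..v, f (u₁, w) := by
    intro u₁ hu₁
    have hsub : Icc u₁ u ×ˢ Icc 1 v ⊆ D := fun p hp => ⟨hp.1.2.trans hu, hp.2.1⟩
    refine integral_right_le_integral_left hu₁ hv (hfcont.mono hsub) (hgcont.mono hsub) ?_
      (fun s hs => hbot s (hs.2.trans hu)) fun s hs => hnonneg _ _ ⟨hs.2.trans hu, hv⟩
    intro s w hs hw
    have hs' : s < -1 := hs.2.trans_le hu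
    obtain ⟨V', hV, hV'⟩ := hr.exists_hasFDerivAt_comp hs' hw.1
      (differentiableAt_reggeWheelerPotential (hr0 (s, w) ⟨hs'.le, hw.1.le⟩))
    exact exists_hasFDerivAt_fluxDensity_of_wave hΦ hs' hw.1 (hRW s w ⟨hs'.le, hw.1.le⟩) hV hV'
  have hlim : Tendsto (fun s => ∫ w in (1 : ℝ)..v, f (s, w)) atBot (nhds 0) := by
    refine (hflux v hv).congr' ?_
    filter_upwards [Iio_mem_atBot (-1 : ℝ)] with s hs
    refine integral_congr_ae (Eventually.of_forall fun w hw => ?_)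
    rw [uIoc_of_le hv] at hw
    have := (hasFDerivAt_fderivWithin_D hΦ hs hw.1).hasDerivAt_right.deriv
    simp only [hf, fluxDensity, ← this]
    rfl
  have hle : ∫ w in (1 : ℝ)..v, f (u, w) ≤ 0 :=
    ge_of_tendsto hlim ((eventually_le_atBot u).mono hmono)
  by_contra hne
  refine hle.not_gt (integral_pos hv1 ?_ (fun w hw => hnonneg _ _ ⟨hu, hw.1.le⟩)
    ⟨v, right_mem_Icc.2 hv, ?_⟩)
  · exact hfcont.comp (by fun_prop) fun w hw => ⟨hu, hw.1⟩
  · have h1 : 0 < V (u, v) := hVpos _ ⟨hu, hv⟩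
    have h2 : 0 < φ (u, v) ^ 2 := by
      have : φ (u, v) ≠ 0 := hne
      positivity
    simp only [hf, fluxDensity]
    positivity
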